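/- Let 0 < λ ≤ Λ and N ≥ 2 an integer with Ñ := (λ/Λ)(N−1) + 1 > 2. Assume: (a) there exists a normalized fast-decaying entire solution U at exponent p⋆ > 1; (b) the Dirichlet problem in the unit ball with exponent p⋆ has no positive radial solution. Let εₙ → 0⁺ with pₙ := p⋆ − εₙ > 1, let uₙ be positive radial solutions of the Dirichlet problem with exponent pₙ having a unique inflection radius r₀(n) ∈ (0,1), set Mₙ := uₙ(0), ρₙ := Mₙ^{(pₙ−1)/2} and ũₙ(r) := Mₙ⁻¹·uₙ(r/ρₙ) for 0 ≤ r ≤ ρₙ. Then there exist a constant C > 0 and an index n₀ such that for all n ≥ n₀ and all r ∈ (0, ρₙ]: ũₙ(r) ≤ C·r^{2−Ñ} and |ũₙ'(r)| ≤ C·r^{1−Ñ}. -/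

import Mathlib

open Real Filter Set

/-- The radial Pucci maximal operator `M⁺_{λ,Λ}` applied to a radial C² function `u`
of the radial variable `r`. -/
noncomputable def radialPucci (lam Lam : ℝ) (N : ℕ) (u : ℝ → ℝ) (r : ℝ) : ℝ :=
  Lam * max (deriv (deriv u) r) 0 + lam * min (deriv (deriv u) r) 0 +
    ((N : ℝ) - 1) * (Lam * max (deriv u r / r) 0 + lam * min (deriv u r / r) 0)

/-- A positive radial solution of the Dirichlet problem `-M⁺[u] = u^q` in the unit ball. -/
def IsDirichletSol (lam Lam : ℝ) (N : ℕ) (q : ℝ) (u : ℝ → ℝ) : Prop :=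
  ContDiffOn ℝ 2 u (Set.Icc 0 1) ∧
    (∀ r ∈ Set.Ico (0 : ℝ) 1, 0 < u r) ∧
    u 1 = 0 ∧ deriv u 0 = 0 ∧
    (∀ r ∈ Set.Icc (0 : ℝ) 1, deriv u r ≤ 0) ∧
    (∀ r ∈ Set.Ioo (0 : ℝ) 1, -radialPucci lam Lam N u r = u r ^ q)

/-- `r0 ∈ (0,1)` is the (unique) inflection radius of `u` in the unit ball. -/
def InflectionAt (u : ℝ → ℝ) (r0 : ℝ) : Prop :=
  r0 ∈ Set.Ioo (0 : ℝ) 1 ∧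
    (∀ r ∈ Set.Ico (0 : ℝ) r0, deriv (deriv u) r < 0) ∧
    deriv (deriv u) r0 = 0 ∧
    (∀ r ∈ Set.Ioo r0 (1 : ℝ), 0 < deriv (deriv u) r)

/-- A normalized fast-decaying entire radial solution of `-M⁺[U] = U^{p⋆}` in `ℝ^N`,
with fast-decay constant `c1` and inflection radius `R0`. -/
def IsEntireSol (lam Lam : ℝ) (N : ℕ) (Ntil pstar c1 R0 : ℝ) (U : ℝ → ℝ) : Prop :=
  ContDiffOn ℝ 2 U (Set.Ici 0) ∧
    (∀ r : ℝ, 0 ≤ r → 0 < U r) ∧ U 0 = 1 ∧ deriv U 0 = 0 ∧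
    (∀ r : ℝ, 0 < r → deriv U r < 0) ∧
    (∀ r : ℝ, 0 < r → -radialPucci lam Lam N U r = U r ^ pstar) ∧
    0 < R0 ∧
    (∀ r ∈ Set.Ico (0 : ℝ) R0, deriv (deriv U) r < 0) ∧
    deriv (deriv U) R0 = 0 ∧
    (∀ r : ℝ, R0 < r → 0 < deriv (deriv U) r) ∧
    0 < c1 ∧
    Filter.Tendsto (fun r : ℝ => r ^ (Ntil - 2) * U r) Filter.atTop (nhds c1) ∧
    Filter.Tendsto (fun r : ℝ => r ^ (Ntil - 1) * deriv U r) Filter.atTop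
      (nhds (-(Ntil - 2) * c1))

lemma rpow_sub_rpow_le_mul {a b p : ℝ} (hb : 0 ≤ b) (hba : b ≤ a) (ha : a ≤ 1) (hp : 1 ≤ p) :
    a ^ p - b ^ p ≤ p * (a - b) := by
  rcases (hb.trans hba).eq_or_lt with h | h
  · obtain rfl : b = a := by linarith
    simp
  have h1 : (b / a) ^ p ≥ 1 + p * (b / a - 1) := by
    have := one_add_mul_self_le_rpow_one_add (s := b / a - 1) (p := p)
      (by have : 0 ≤ b / a := by positivity
          linarith) hp
    simpa using this
  rw [div_rpow hb h.le] at h1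
  have h2 : 0 < a ^ p := by positivity
  have h3 : a ^ p - b ^ p ≤ a ^ p * (p * (1 - b / a)) := by
    have : a ^ p * (b ^ p / a ^ p) = b ^ p := by field_simp
    nlinarith
  have h4 : a ^ p ≤ a := by
    simpa using rpow_le_rpow_of_exponent_ge h ha hp
  have h5 : 0 ≤ p * (1 - b / a) := by
    have : b / a ≤ 1 := by rw [div_le_one h]; exact hba
    exact mul_nonneg (by linarith) (by linarith)
  calc a ^ p - b ^ p ≤ a ^ p * (p * (1 - b / a)) := h3
    _ ≤ a * (p * (1 - b / a)) := by gcongr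
    _ = p * (a - b) := by field_simp

lemma abs_rpow_sub_rpow_le_mul {a b p : ℝ} (ha0 : 0 ≤ a) (hb0 : 0 ≤ b) (ha : a ≤ 1) (hb : b ≤ 1)
    (hp : 1 ≤ p) : |a ^ p - b ^ p| ≤ p * |a - b| := by
  rcases le_total b a with h | h
  · rw [abs_of_nonneg (sub_nonneg.2 h),
      abs_of_nonneg (sub_nonneg.2 (rpow_le_rpow hb0 h (by linarith)))]
    exact rpow_sub_rpow_le_mul hb0 h ha hp
  · rw [abs_of_nonpos (sub_nonpos.2 h),
      abs_of_nonpos (sub_nonpos.2 (rpow_le_rpow ha0 h (by linarith)))]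
    simpa using rpow_sub_rpow_le_mul ha0 h hb hp

lemma abs_rpow_sub_rpow_exponent_le {x p q : ℝ} (hx : 0 < x) (hx1 : x ≤ 1) (hp : 1 ≤ p)
    (hpq : p ≤ q) : |x ^ p - x ^ q| ≤ q - p := by
  rw [abs_of_nonneg (sub_nonneg.2 (rpow_le_rpow_of_exponent_ge hx hx1 hpq))]
  have h1 : x ^ q = x ^ p * x ^ (q - p) := by rw [← rpow_add hx]; ring_nf
  have h2 : 1 + log x * (q - p) ≤ x ^ (q - p) := by
    rw [rpow_def_of_pos hx]
    linarith [add_one_le_exp (log x * (q - p))]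
  have h3 : x ^ p ≤ x := by simpa using rpow_le_rpow_of_exponent_ge hx hx1 hp
  have h4 : 0 < x ^ p := by positivity
  have h5 : 0 ≤ -log x := by linarith [log_nonpos hx.le hx1]
  have h6 : x * -log x ≤ 1 := by
    have := one_sub_inv_le_log_of_pos hx
    have h7 : x * (-log x) ≤ x * (x⁻¹ - 1) := by gcongr; linarith
    rw [mul_sub, mul_inv_cancel₀ hx.ne'] at h7
    linarith
  calc x ^ p - x ^ q = x ^ p * (1 - x ^ (q - p)) := by rw [h1]; ring
    _ ≤ x ^ p * (-log x * (q - p)) := by gcongr; linarith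
    _ ≤ x * (-log x * (q - p)) := by
        gcongr
    _ = (x * -log x) * (q - p) := by ring
    _ ≤ 1 * (q - p) := by gcongr
    _ = q - p := one_mul _

/-- `v` solves the radial equation `-M⁺[v] = v ^ p` on `(0, ρ)`, is positive and nonincreasing
there, and satisfies `v 0 = 1`, `v' 0 = 0`. -/
structure IsRadialProfile (lam Lam k p ρ : ℝ) (v : ℝ → ℝ) : Prop where
  cont : ContinuousOn v (Ico 0 ρ)
  cont_deriv : ContinuousOn (deriv v) (Ico 0 ρ)
  hasDerivAt : ∀ r ∈ Ioo 0 ρ, HasDerivAt v (deriv v r) r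
  hasDerivAt_deriv : ∀ r ∈ Ioo 0 ρ, HasDerivAt (deriv v) (deriv (deriv v) r) r
  map_zero : v 0 = 1
  deriv_zero : deriv v 0 = 0
  pos : ∀ r ∈ Ico 0 ρ, 0 < v r
  deriv_nonpos : ∀ r ∈ Ioo 0 ρ, deriv v r ≤ 0
  equation : ∀ r ∈ Ioo 0 ρ, Lam * max (deriv (deriv v) r) 0 + lam * min (deriv (deriv v) r) 0 +
    k * (deriv v r / r) = -v r ^ p

namespace IsRadialProfile

variable {lam Lam k p q ρ : ℝ} {v U : ℝ → ℝ}

lemma antitoneOn (hv : IsRadialProfile lam Lam k p ρ v) : AntitoneOn v (Ico 0 ρ) := by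
  refine antitoneOn_of_deriv_nonpos (convex_Ico _ _) hv.cont ?_ ?_
  · rw [interior_Ico]
    exact fun x hx => (hv.hasDerivAt x hx).differentiableAt.differentiableWithinAt
  · rw [interior_Ico]
    exact hv.deriv_nonpos

lemma le_one (hv : IsRadialProfile lam Lam k p ρ v) {r : ℝ} (hr : r ∈ Ico 0 ρ) : v r ≤ 1 := by
  rw [← hv.map_zero]
  exact hv.antitoneOn ⟨le_rfl, hr.1.trans_lt hr.2⟩ hr hr.1

/-- The principal part of the Pucci operator is coercive and the first-order term is dissipative. -/
lemma mul_sub_mul_sub_le (hlam : 0 < lam) (hlL : lam ≤ Lam) {c a a' b b' g g' : ℝ} (hc : 0 ≤ c)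
    (h : Lam * max a 0 + lam * min a 0 + c * b = -g)
    (h' : Lam * max a' 0 + lam * min a' 0 + c * b' = -g') :
    (b - b') * (a - a') ≤ |b - b'| * (|g - g'| / lam) := by
  have key : ∀ {a a' b b' g g' : ℝ}, Lam * max a 0 + lam * min a 0 + c * b = -g →
      Lam * max a' 0 + lam * min a' 0 + c * b' = -g' → b' ≤ b →
      (b - b') * (a - a') ≤ |b - b'| * (|g - g'| / lam) := by
    intro a a' b b' g g' h h' hb
    rw [abs_of_nonneg (sub_nonneg.2 hb)]
    refine mul_le_mul_of_nonneg_left ?_ (sub_nonneg.2 hb)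
    rw [le_div_iff₀ hlam]
    rcases le_total a a' with ha | ha
    · have := abs_nonneg (g - g')
      nlinarith
    · have h1 : lam * (a - a') ≤
          (Lam * max a 0 + lam * min a 0) - (Lam * max a' 0 + lam * min a' 0) := by
        rcases le_total a 0 with h1 | h1 <;> rcases le_total a' 0 with h2 | h2 <;>
          simp only [h1, h2, max_eq_left, max_eq_right, min_eq_left, min_eq_right] <;> nlinarith
      have h2 : 0 ≤ c * (b - b') := mul_nonneg hc (sub_nonneg.2 hb)
      have h3 := neg_le_abs (g - g')
      nlinarith
  rcases le_total b' b with hb | hb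
  · exact key h h' hb
  · have := key h' h hb
    rw [abs_sub_comm b b', abs_sub_comm g g']
    linarith

/-- Continuous dependence of the profiles on the exponent. -/
lemma sq_add_sq_le (hlam : 0 < lam) (hlL : lam ≤ Lam) (hk : 0 ≤ k) (hp : 1 ≤ p) (hpq : p ≤ q)
    (hv : IsRadialProfile lam Lam k p ρ v) (hU : IsRadialProfile lam Lam k q ρ U)
    {r : ℝ} (hr : r ∈ Ico 0 ρ) :
    (v r - U r) ^ 2 + (deriv v r - deriv U r) ^ 2 ≤
      (q - p) ^ 2 * exp ((1 + (q + 1) / lam) * r) := by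
  set A := 1 + (q + 1) / lam with hA
  set η := q - p with hη
  set e : ℝ → ℝ := fun r => (v r - U r) ^ 2 + (deriv v r - deriv U r) ^ 2 with he
  set e' : ℝ → ℝ := fun r => 2 * (v r - U r) * (deriv v r - deriv U r) +
    2 * (deriv v r - deriv U r) * (deriv (deriv v) r - deriv (deriv U) r) with he'
  have hd : ∀ x ∈ Ioo 0 ρ, HasDerivAt e (e' x) x := by
    intro x hx
    have h1 := ((hv.hasDerivAt x hx).sub (hU.hasDerivAt x hx)).pow 2
    have h2 := ((hv.hasDerivAt_deriv x hx).sub (hU.hasDerivAt_deriv x hx)).pow 2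
    refine (h1.add h2).congr_deriv ?_
    simp [he']
  have hle : ∀ x ∈ Ioo 0 ρ, e' x ≤ A * (e x + η ^ 2) := by
    intro x hx
    have hx' : x ∈ Ico 0 ρ := ⟨hx.1.le, hx.2⟩
    have h1 := mul_sub_mul_sub_le hlam hlL (c := k / x) (by have := hx.1; positivity)
      (g := v x ^ p) (g' := U x ^ q) (a := deriv (deriv v) x) (b := deriv v x)
      (a' := deriv (deriv U) x) (b' := deriv U x)
      (by rw [← hv.equation x hx]; ring) (by rw [← hU.equation x hx]; ring)
    have h2 : |v x ^ p - U x ^ q| ≤ q * |v x - U x| + η := by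
      calc |v x ^ p - U x ^ q| ≤ |v x ^ p - U x ^ p| + |U x ^ p - U x ^ q| := abs_sub_le _ _ _
        _ ≤ p * |v x - U x| + η :=
          add_le_add (abs_rpow_sub_rpow_le_mul (hv.pos x hx').le (hU.pos x hx').le (hv.le_one hx')
            (hU.le_one hx') hp) (abs_rpow_sub_rpow_exponent_le (hU.pos x hx') (hU.le_one hx') hp hpq)
        _ ≤ q * |v x - U x| + η := by gcongr
    have h3 : |deriv v x - deriv U x| * (|v x ^ p - U x ^ q| / lam) ≤
        |deriv v x - deriv U x| * ((q * |v x - U x| + η) / lam) := by gcongr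
    simp only [he, he', hA]
    set w := v x - U x
    set d := deriv v x - deriv U x
    have hq : 0 ≤ q := by linarith
    have h4 : 2 * (|d| * ((q * |w| + η) / lam)) ≤ (q * (w ^ 2 + d ^ 2) + (d ^ 2 + η ^ 2)) / lam := by
      rw [← mul_div_assoc, ← mul_div_assoc]
      gcongr
      nlinarith [mul_nonneg hq (sq_nonneg (|d| - |w|)), sq_nonneg (|d| - η), sq_abs d, sq_abs w]
    have h5 : 2 * w * d ≤ w ^ 2 + d ^ 2 := by nlinarith [sq_nonneg (w - d)]
    have h6 : (q * (w ^ 2 + d ^ 2) + (d ^ 2 + η ^ 2)) / lam ≤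
        (q + 1) / lam * (w ^ 2 + d ^ 2 + η ^ 2) := by
      rw [div_mul_eq_mul_div]
      gcongr
      nlinarith [mul_nonneg hq (sq_nonneg η), sq_nonneg w]
    nlinarith [sq_nonneg η]
  have hanti : AntitoneOn (fun x => (e x + η ^ 2) * exp (-A * x)) (Ico 0 ρ) := by
    have hd2 : ∀ x ∈ Ioo 0 ρ, HasDerivAt (fun x => (e x + η ^ 2) * exp (-A * x))
        ((e' x - A * (e x + η ^ 2)) * exp (-A * x)) x := by
      intro x hx
      have h1 : HasDerivAt (fun x => exp (-A * x)) (exp (-A * x) * (-A)) x := by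
        simpa using ((hasDerivAt_id x).const_mul (-A)).exp
      exact (((hd x hx).add_const _).mul h1).congr_deriv (by ring)
    refine antitoneOn_of_deriv_nonpos (convex_Ico _ _) ?_ ?_ ?_
    · refine ContinuousOn.mul (ContinuousOn.add ?_ continuousOn_const) (by fun_prop)
      exact ((hv.cont.sub hU.cont).pow 2).add ((hv.cont_deriv.sub hU.cont_deriv).pow 2)
    · rw [interior_Ico]
      exact fun x hx => (hd2 x hx).differentiableAt.differentiableWithinAt
    · rw [interior_Ico]
      intro x hx
      rw [(hd2 x hx).deriv]
      exact mul_nonpos_of_nonpos_of_nonneg (by linarith [hle x hx]) (exp_pos _).le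
  have h1 := hanti ⟨le_rfl, hr.1.trans_lt hr.2⟩ hr hr.1
  have h0 : e 0 = 0 := by
    simp [he, hv.map_zero, hU.map_zero, hv.deriv_zero, hU.deriv_zero]
  simp only [h0, zero_add, mul_zero, exp_zero, mul_one, neg_mul] at h1
  rw [exp_neg, ← div_eq_mul_inv, div_le_iff₀ (exp_pos _)] at h1
  have : e r ≤ η ^ 2 * exp (A * r) := by linarith [sq_nonneg η]
  exact this

end IsRadialProfile

/-- `v` is a positive, nonincreasing, convex solution of `Lam (v'' + (a - 1) v' / r) = -v ^ p`
on `[R, ρ)`. -/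
structure IsConvexTail (a Lam p R ρ : ℝ) (v : ℝ → ℝ) : Prop where
  hasDerivAt : ∀ r ∈ Ico R ρ, HasDerivAt v (deriv v r) r
  hasDerivAt_deriv : ∀ r ∈ Ico R ρ, HasDerivAt (deriv v) (deriv (deriv v) r) r
  pos : ∀ r ∈ Ico R ρ, 0 < v r
  deriv_nonpos : ∀ r ∈ Ico R ρ, deriv v r ≤ 0
  deriv_deriv_pos : ∀ r ∈ Ico R ρ, 0 < deriv (deriv v) r
  equation : ∀ r ∈ Ico R ρ, Lam * (deriv (deriv v) r + (a - 1) * (deriv v r / r)) = -v r ^ p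

/-- The flux `-r ^ (a - 1) v'(r)` of a radial function in dimension `a`. -/
noncomputable def radialFlux (a : ℝ) (v : ℝ → ℝ) (r : ℝ) : ℝ := -(r ^ (a - 1) * deriv v r)

lemma deriv_eq_neg_radialFlux_mul {a r : ℝ} (v : ℝ → ℝ) (hr : 0 < r) :
    deriv v r = -(radialFlux a v r * r ^ (1 - a)) := by
  have : r ^ (a - 1) * r ^ (1 - a) = 1 := by
    rw [← rpow_add hr]; simp
  rw [radialFlux]
  linear_combination (-deriv v r) * this

namespace IsConvexTail

variable {a Lam p q R ρ B C S γ θ : ℝ} {v : ℝ → ℝ}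

lemma mono {R' : ℝ} (hv : IsConvexTail a Lam p R ρ v) (h : R ≤ R') :
    IsConvexTail a Lam p R' ρ v where
  hasDerivAt r hr := hv.hasDerivAt r ⟨h.trans hr.1, hr.2⟩
  hasDerivAt_deriv r hr := hv.hasDerivAt_deriv r ⟨h.trans hr.1, hr.2⟩
  pos r hr := hv.pos r ⟨h.trans hr.1, hr.2⟩
  deriv_nonpos r hr := hv.deriv_nonpos r ⟨h.trans hr.1, hr.2⟩
  deriv_deriv_pos r hr := hv.deriv_deriv_pos r ⟨h.trans hr.1, hr.2⟩
  equation r hr := hv.equation r ⟨h.trans hr.1, hr.2⟩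

lemma hasDerivAt_flux (hLam : 0 < Lam) (hR : 0 < R) (hv : IsConvexTail a Lam p R ρ v) {r : ℝ}
    (hr : r ∈ Ico R ρ) :
    HasDerivAt (radialFlux a v) (r ^ (a - 1) * v r ^ p / Lam) r := by
  have hr0 : 0 < r := hR.trans_le hr.1
  have h1 := (((hasDerivAt_id r).rpow_const (p := a - 1) (Or.inl hr0.ne')).mul
    (hv.hasDerivAt_deriv r hr)).neg
  refine h1.congr_deriv ?_
  have h2 : v r ^ p = -(Lam * (deriv (deriv v) r + (a - 1) * (deriv v r / r))) := by
    rw [hv.equation r hr]; ring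
  rw [h2, id, rpow_sub_one hr0.ne']
  field_simp
  ring

lemma rpow_lt (hLam : 0 < Lam) (hR : 0 < R) (hv : IsConvexTail a Lam p R ρ v) {r : ℝ}
    (hr : r ∈ Ico R ρ) :
    v r ^ p * r ^ a < Lam * (a - 1) * radialFlux a v r := by
  have hr0 : 0 < r := hR.trans_le hr.1
  have h1 := hv.equation r hr
  have h2 := mul_pos hLam (hv.deriv_deriv_pos r hr)
  have h3 : v r ^ p < -(Lam * (a - 1) * deriv v r / r) := by
    have : Lam * ((a - 1) * (deriv v r / r)) = Lam * (a - 1) * deriv v r / r := by ring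
    linarith
  have h4 : 0 < r ^ a := by positivity
  calc v r ^ p * r ^ a < -(Lam * (a - 1) * deriv v r / r) * r ^ a := by gcongr
    _ = Lam * (a - 1) * radialFlux a v r := by
      rw [radialFlux, rpow_sub_one hr0.ne']
      ring

lemma antitoneOn (hv : IsConvexTail a Lam p R ρ v) : AntitoneOn v (Ico R ρ) := by
  refine antitoneOn_of_deriv_nonpos (convex_Ico _ _)
    (fun x hx => (hv.hasDerivAt x hx).continuousAt.continuousWithinAt) ?_ ?_
  · exact fun x hx => (hv.hasDerivAt x (interior_subset hx)).differentiableAt.differentiableWithinAt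
  · exact fun x hx => hv.deriv_nonpos x (interior_subset hx)

lemma flux_le_of_le (hLam : 0 < Lam) (hR : 1 ≤ R) (hp : 0 ≤ p) (hpq : p ≤ q) (hC : 1 ≤ C)
    (hγ : 0 < γ) (hpγ : 2 * γ ≤ p * (a - 2) - a) (hv : IsConvexTail a Lam p R ρ v)
    (hRB : C ^ q * R ^ (-(2 * γ)) ≤ 2 * γ * Lam * B) (hB : radialFlux a v R ≤ B)
    {s : ℝ} (hs : s ∈ Ico R ρ) (hle : ∀ r ∈ Ioo R s, v r ≤ C * r ^ (2 - a)) :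
    radialFlux a v s ≤ 2 * B := by
  have hR0 : 0 < R := by linarith
  set K := C ^ q / (2 * γ * Lam) with hK
  have hsub : ∀ x ∈ Icc R s, x ∈ Ico R ρ := fun x hx => ⟨hx.1, hx.2.trans_lt hs.2⟩
  have hd : ∀ x ∈ Icc R s, HasDerivAt (fun r => radialFlux a v r + K * r ^ (-(2 * γ)))
      (x ^ (a - 1) * v x ^ p / Lam + K * (-(2 * γ) * x ^ (-(2 * γ) - 1))) x := by
    intro x hx
    exact (hv.hasDerivAt_flux hLam hR0 (hsub x hx)).add
      ((Real.hasDerivAt_rpow_const (Or.inl (hR0.trans_le hx.1).ne')).const_mul K)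
  have hanti : AntitoneOn (fun r => radialFlux a v r + K * r ^ (-(2 * γ))) (Icc R s) := by
    refine antitoneOn_of_deriv_nonpos (convex_Icc _ _)
      (fun x hx => (hd x hx).continuousAt.continuousWithinAt)
      (fun x hx => (hd x (interior_subset hx)).differentiableAt.differentiableWithinAt) ?_
    rw [interior_Icc]
    intro x hx
    rw [(hd x (Ioo_subset_Icc_self hx)).deriv]
    have hx1 : 1 ≤ x := hR.trans hx.1.le
    have hx0 : 0 < x := by linarith
    have h1 : v x ^ p ≤ C ^ q * x ^ ((2 - a) * p) := by
      calc v x ^ p ≤ (C * x ^ (2 - a)) ^ p :=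
            rpow_le_rpow (hv.pos x (hsub x (Ioo_subset_Icc_self hx))).le (hle x hx) hp
        _ = C ^ p * x ^ ((2 - a) * p) := by
            rw [mul_rpow (by linarith) (by positivity), ← rpow_mul hx0.le]
        _ ≤ C ^ q * x ^ ((2 - a) * p) := by gcongr
    have h2 : x ^ (a - 1) * v x ^ p ≤ C ^ q * x ^ (-(2 * γ) - 1) := by
      calc x ^ (a - 1) * v x ^ p ≤ x ^ (a - 1) * (C ^ q * x ^ ((2 - a) * p)) := by gcongr
        _ = C ^ q * x ^ (a - 1 + (2 - a) * p) := by rw [rpow_add hx0]; ring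
        _ ≤ C ^ q * x ^ (-(2 * γ) - 1) := by
            gcongr
            linarith
    have h3 : K * (-(2 * γ) * x ^ (-(2 * γ) - 1)) = -(C ^ q * x ^ (-(2 * γ) - 1) / Lam) := by
      rw [hK]; field_simp
    rw [h3]
    have : x ^ (a - 1) * v x ^ p / Lam ≤ C ^ q * x ^ (-(2 * γ) - 1) / Lam := by gcongr
    linarith
  have h1 := hanti ⟨le_rfl, hs.1⟩ ⟨hs.1, le_rfl⟩ hs.1
  simp only at h1
  have h2 : 0 ≤ K * s ^ (-(2 * γ)) := by
    have : 0 < s := hR0.trans_le hs.1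
    positivity
  have h3 : K * R ^ (-(2 * γ)) ≤ B := by
    rw [hK, div_mul_eq_mul_div, div_le_iff₀ (by positivity)]
    linarith
  linarith

lemma flux_le_add (hLam : 0 < Lam) (ha : 0 < a) (hR : 0 < R) (hp : 0 ≤ p)
    (hv : IsConvexTail a Lam p R ρ v) {r : ℝ} (hr : r ∈ Ico R ρ) :
    radialFlux a v r ≤ radialFlux a v R + v R ^ p * r ^ a / (Lam * a) := by
  have hsub : ∀ x ∈ Icc R r, x ∈ Ico R ρ := fun x hx => ⟨hx.1, hx.2.trans_lt hr.2⟩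
  have hd : ∀ x ∈ Icc R r, HasDerivAt (fun r => radialFlux a v r - v R ^ p * r ^ a / (Lam * a))
      (x ^ (a - 1) * v x ^ p / Lam - v R ^ p * (a * x ^ (a - 1)) / (Lam * a)) x := by
    intro x hx
    exact (hv.hasDerivAt_flux hLam hR (hsub x hx)).sub
      (((Real.hasDerivAt_rpow_const (Or.inl (hR.trans_le hx.1).ne')).const_mul _).div_const _)
  have hanti : AntitoneOn (fun r => radialFlux a v r - v R ^ p * r ^ a / (Lam * a)) (Icc R r) := by
    refine antitoneOn_of_deriv_nonpos (convex_Icc _ _)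
      (fun x hx => (hd x hx).continuousAt.continuousWithinAt)
      (fun x hx => (hd x (interior_subset hx)).differentiableAt.differentiableWithinAt) ?_
    intro x hx
    have hx := interior_subset hx
    rw [(hd x hx).deriv]
    have hx0 : 0 < x := hR.trans_le hx.1
    have h1 : v x ^ p ≤ v R ^ p :=
      rpow_le_rpow (hv.pos x (hsub x hx)).le
        (hv.antitoneOn ⟨le_rfl, hr.1.trans_lt hr.2⟩ (hsub x hx) hx.1) hp
    have h2 : v R ^ p * (a * x ^ (a - 1)) / (Lam * a) = x ^ (a - 1) * v R ^ p / Lam := by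
      field_simp
    rw [h2]
    have : x ^ (a - 1) * v x ^ p / Lam ≤ x ^ (a - 1) * v R ^ p / Lam := by gcongr
    linarith
  have h1 := hanti ⟨le_rfl, hr.1⟩ ⟨hr.1, le_rfl⟩ hr.1
  simp only at h1
  have h2 : 0 ≤ v R ^ p * R ^ a / (Lam * a) := by
    have := hv.pos R ⟨le_rfl, hr.1.trans_lt hr.2⟩
    positivity
  linarith

lemma sub_le (hLam : 0 < Lam) (ha : 2 < a) (hR : 0 < R) (hp : 0 ≤ p) (hB : 0 ≤ B)
    (hv : IsConvexTail a Lam p R ρ v) (hRρ : R < ρ)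
    (hcont : ContinuousOn v (Icc R ρ)) (hflux : radialFlux a v R ≤ B) {r : ℝ} (hr : r ∈ Icc R ρ) :
    v R - B * R ^ (2 - a) / (a - 2) - v R ^ p * r ^ 2 / (2 * Lam * a) ≤ v r := by
  have hd : ∀ x ∈ Ioo R ρ, HasDerivAt
      (fun r => v r - B * r ^ (2 - a) / (a - 2) + v R ^ p * r ^ 2 / (2 * Lam * a))
      (deriv v x - B * ((2 - a) * x ^ (2 - a - 1)) / (a - 2) +
        v R ^ p * (2 * x) / (2 * Lam * a)) x := by
    intro x hx
    have h1 := ((Real.hasDerivAt_rpow_const (p := 2 - a)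
      (Or.inl (hR.trans hx.1).ne')).const_mul B).div_const (a - 2)
    have h2 := ((hasDerivAt_pow 2 x).const_mul (v R ^ p)).div_const (2 * Lam * a)
    refine (((hv.hasDerivAt x ⟨hx.1.le, hx.2⟩).sub h1).add h2).congr_deriv ?_
    simp
  have hmono : MonotoneOn
      (fun r => v r - B * r ^ (2 - a) / (a - 2) + v R ^ p * r ^ 2 / (2 * Lam * a)) (Icc R ρ) := by
    refine monotoneOn_of_deriv_nonneg (convex_Icc _ _) ?_ ?_ ?_
    · refine (hcont.sub ?_).add (by fun_prop)
      refine ContinuousOn.div_const (continuousOn_const.mul ?_) _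
      exact fun x hx =>
        (continuousAt_rpow_const x _ (Or.inl (hR.trans_le hx.1).ne')).continuousWithinAt
    · rw [interior_Icc]
      exact fun x hx => (hd x hx).differentiableAt.differentiableWithinAt
    · rw [interior_Icc]
      intro x hx
      rw [(hd x hx).deriv]
      have hx0 : 0 < x := hR.trans hx.1
      have h1 := hv.flux_le_add hLam (by linarith) hR hp ⟨hx.1.le, hx.2⟩
      have h2 : radialFlux a v x * x ^ (1 - a) ≤
          (B + v R ^ p * x ^ a / (Lam * a)) * x ^ (1 - a) := by
        gcongr
        linarith
      have h3 : x ^ a * x ^ (1 - a) = x := by rw [← rpow_add hx0]; simp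
      have h4 : B * ((2 - a) * x ^ (2 - a - 1)) / (a - 2) = -(B * x ^ (1 - a)) := by
        rw [show 2 - a - 1 = 1 - a by ring]
        have : a - 2 ≠ 0 := by linarith
        field_simp
        ring
      have h5 : v R ^ p * (2 * x) / (2 * Lam * a) = v R ^ p * x ^ a / (Lam * a) * x ^ (1 - a) := by
        calc v R ^ p * (2 * x) / (2 * Lam * a) = v R ^ p * x / (Lam * a) := by field_simp
          _ = v R ^ p * (x ^ a * x ^ (1 - a)) / (Lam * a) := by rw [h3]
          _ = _ := by ring
      rw [deriv_eq_neg_radialFlux_mul (a := a) v hx0, h4, h5]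
      linarith
  have h1 := hmono ⟨le_rfl, hr.1.trans hr.2⟩ hr hr.1
  simp only at h1
  have hr0 : 0 < r := hR.trans_le hr.1
  have h2 : 0 ≤ B * r ^ (2 - a) / (a - 2) := by
    have : 0 < a - 2 := by linarith
    positivity
  have h3 : 0 ≤ v R ^ p * R ^ 2 / (2 * Lam * a) := by
    have := hv.pos R ⟨le_rfl, hRρ⟩
    positivity
  linarith

lemma false_of_eq (hLam : 0 < Lam) (ha : 2 < a) (hR : 1 ≤ R) (hp : 1 ≤ p) (hpq : p ≤ q)
    (hB : 0 ≤ B) (hC : 1 ≤ C) (hθ : 0 < θ) (hθq : 8 * q * a * θ ≤ 1)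
    (hCB : 2 * B ≤ C * ((a - 2) * θ)) (hpγ : 2 * γ ≤ p * (a - 2) - a) (hS : 1 ≤ S)
    (hSB : 8 * B * Lam * a ^ 2 ≤ 2 * Lam * a * θ * C * S ^ (a - 2))
    (hRS : C ^ q * R ^ (-(2 * γ)) * S ^ 2 ≤ 2 * Lam * a * θ)
    (hv : IsConvexTail a Lam p R ρ v) (hRρ : R < ρ) (hcont : ContinuousOn v (Icc R ρ))
    (hvρ : v ρ = 0) (hflux : radialFlux a v R ≤ 2 * B) (hvR : v R = C * R ^ (2 - a)) : False := by
  have hR0 : 0 < R := by linarith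
  have ha2 : 0 < a - 2 := by linarith
  have hRρ' : R ∈ Ico R ρ := ⟨le_rfl, hRρ⟩
  set c := 2 * Lam * a * θ with hc
  have hc0 : 0 < c := by positivity
  set m := v R with hm
  have hm0 : 0 < m := hv.pos R hRρ'
  set h := m ^ (p - 1) * R ^ 2 with hh
  have hh0 : 0 < h := by positivity
  have hhle : h ≤ C ^ q * R ^ (-(2 * γ)) := by
    calc h = C ^ (p - 1) * R ^ ((2 - a) * (p - 1) + 2) := by
          rw [hh, hvR, mul_rpow (by linarith) (by positivity), ← rpow_mul hR0.le, rpow_add hR0,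
            rpow_two]
          ring
      _ ≤ C ^ q * R ^ (-(2 * γ)) := by
          gcongr <;> linarith
  set s := √(c / h) with hs
  have hs2 : s ^ 2 = c / h := sq_sqrt (by positivity)
  have hSs : S ≤ s := by
    refine le_sqrt_of_sq_le ?_
    rw [le_div_iff₀ hh0]
    calc S ^ 2 * h ≤ S ^ 2 * (C ^ q * R ^ (-(2 * γ))) := by gcongr
      _ ≤ c := by linarith
  have hs1 : 1 ≤ s := hS.trans hSs
  set t := s * R with ht
  have hRt : R ≤ t := le_mul_of_one_le_left hR0.le hs1
  have ht0 : 0 < t := by linarith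
  have hmp : m ^ p = m ^ (p - 1) * m := by
    rw [rpow_sub_one hm0.ne']; field_simp
  have hmt : m ^ p * t ^ 2 = c * m := by
    calc m ^ p * t ^ 2 = (m ^ (p - 1) * R ^ 2) * m * s ^ 2 := by rw [hmp, ht]; ring
      _ = c * m := by rw [hs2, ← hh]; field_simp
  have hmta : m ^ p * t ^ a = c * C * s ^ (a - 2) := by
    have h1 : t ^ a = t ^ 2 * (s ^ (a - 2) * R ^ (a - 2)) := by
      rw [← mul_rpow (by linarith) hR0.le, ← ht, ← rpow_two, ← rpow_add ht0]
      ring_nf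
    have h2 : m * R ^ (a - 2) = C := by
      rw [hvR, mul_assoc, ← rpow_add hR0]
      simp
    calc m ^ p * t ^ a = (m ^ p * t ^ 2) * (s ^ (a - 2) * R ^ (a - 2)) := by rw [h1]; ring
      _ = c * (m * R ^ (a - 2)) * s ^ (a - 2) := by rw [hmt]; ring
      _ = _ := by rw [h2]
  have hlow : ∀ r ∈ Icc R ρ, r ≤ t → m * (1 - 2 * θ) ≤ v r := by
    intro r hr hrt
    have h1 := hv.sub_le hLam ha hR0 (by linarith) (by linarith) hRρ hcont hflux hr
    have h2 : 2 * B * R ^ (2 - a) / (a - 2) ≤ θ * m := by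
      rw [div_le_iff₀ ha2, hvR]
      have : 0 < R ^ (2 - a) := by positivity
      nlinarith
    have h3 : m ^ p * r ^ 2 / (2 * Lam * a) ≤ θ * m := by
      rw [div_le_iff₀ (by positivity)]
      have hr0 : 0 < r := hR0.trans_le hr.1
      calc m ^ p * r ^ 2 ≤ m ^ p * t ^ 2 := by gcongr
        _ = θ * m * (2 * Lam * a) := by rw [hmt, hc]; ring
    linarith
  have hqa : 2 * p * θ ≤ 1 / (4 * a) := by
    rw [le_div_iff₀ (by positivity)]
    have : p * (a * θ) ≤ q * (a * θ) := by gcongr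
    linarith
  have h14 : 1 / (4 * a) ≤ 1 / 8 := by
    gcongr
    linarith
  have hθ1 : 2 * θ ≤ 1 / 8 := by
    have : θ ≤ p * θ := le_mul_of_one_le_left hθ.le hp
    linarith
  have htρ : t < ρ := by
    by_contra! hcon
    have := hlow ρ ⟨hRρ.le, le_rfl⟩ hcon
    rw [hvρ] at this
    have : 0 < m * (1 - 2 * θ) := mul_pos hm0 (by linarith)
    linarith
  have htm : t ∈ Ico R ρ := ⟨hRt, htρ⟩
  have h1 : m ^ p * (1 - 1 / (4 * a)) ≤ v t ^ p := by
    have hb : 1 + p * (-(2 * θ)) ≤ (1 + -(2 * θ)) ^ p :=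
      one_add_mul_self_le_rpow_one_add (by linarith) hp
    calc m ^ p * (1 - 1 / (4 * a)) ≤ m ^ p * (1 + -(2 * θ)) ^ p := by gcongr; linarith
      _ = (m * (1 - 2 * θ)) ^ p := by rw [mul_rpow hm0.le (by linarith)]; ring_nf
      _ ≤ v t ^ p := by
        refine rpow_le_rpow (mul_nonneg hm0.le (by linarith)) (hlow t ⟨hRt, htρ.le⟩ le_rfl)
          (by linarith)
  have h2 := hv.rpow_lt hLam hR0 htm
  have h3 := hv.flux_le_add hLam (by linarith) hR0 (by linarith) htm
  have h4 : Lam * (a - 1) * radialFlux a v t ≤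
      Lam * (a - 1) * (2 * B + m ^ p * t ^ a / (Lam * a)) := by
    refine mul_le_mul_of_nonneg_left (by linarith) (mul_nonneg hLam.le (by linarith))
  have h5 : m ^ p * (1 - 1 / (4 * a)) * t ^ a ≤ v t ^ p * t ^ a := by gcongr
  set X := m ^ p * t ^ a with hX
  have hXge : 8 * B * Lam * a ^ 2 ≤ X := by
    rw [hmta]
    refine hSB.trans ?_
    gcongr
  have hX0 : 0 < X := by positivity
  have h6 : X * (1 - 1 / (4 * a)) < Lam * (a - 1) * (2 * B + X / (Lam * a)) := by
    calc X * (1 - 1 / (4 * a)) = m ^ p * (1 - 1 / (4 * a)) * t ^ a := by rw [hX]; ring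
      _ < _ := by linarith
  have h7 : Lam * (a - 1) * (2 * B + X / (Lam * a)) * (4 * a) =
      8 * B * Lam * a * (a - 1) + 4 * (a - 1) * X := by
    field_simp
    ring
  have h8 : X * (1 - 1 / (4 * a)) * (4 * a) = X * (4 * a - 1) := by
    field_simp
  have h9 : X * (4 * a - 1) < 8 * B * Lam * a * (a - 1) + 4 * (a - 1) * X := by
    rw [← h7, ← h8]
    gcongr
  have h10 : 8 * B * Lam * a * (a - 1) ≤ 8 * B * Lam * a ^ 2 := by
    have : 0 ≤ B * Lam * a := by positivity
    linarith
  linarith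

/-- A convex tail which starts below `C r ^ (2 - a)` with small flux and which vanishes at `ρ` stays
below `C r ^ (2 - a)`, and its flux stays bounded. -/
theorem le_and_flux_le (hLam : 0 < Lam) (ha : 2 < a) (hR : 1 ≤ R) (hp : 1 ≤ p) (hpq : p ≤ q)
    (hB : 0 ≤ B) (hC : 1 ≤ C) (hθ : 0 < θ) (hθq : 8 * q * a * θ ≤ 1)
    (hCB : 2 * B ≤ C * ((a - 2) * θ)) (hγ : 0 < γ) (hpγ : 2 * γ ≤ p * (a - 2) - a) (hS : 1 ≤ S)
    (hSB : 8 * B * Lam * a ^ 2 ≤ 2 * Lam * a * θ * C * S ^ (a - 2))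
    (hRS : C ^ q * R ^ (-(2 * γ)) * S ^ 2 ≤ 2 * Lam * a * θ)
    (hRB : C ^ q * R ^ (-(2 * γ)) ≤ 2 * γ * Lam * B)
    (hv : IsConvexTail a Lam p R ρ v) (hcont : ContinuousOn v (Icc R ρ))
    (hvρ : v ρ = 0) (hflux : radialFlux a v R ≤ B) (hvR : v R < C * R ^ (2 - a)) :
    (∀ r ∈ Icc R ρ, v r ≤ C * r ^ (2 - a)) ∧ ∀ r ∈ Ico R ρ, radialFlux a v r ≤ 2 * B := by
  have hR0 : 0 < R := by linarith
  have hcr : ContinuousOn (fun r => C * r ^ (2 - a)) (Icc R ρ) :=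
    continuousOn_const.mul fun x hx =>
      (continuousAt_rpow_const x _ (Or.inl (hR0.trans_le hx.1).ne')).continuousWithinAt
  have key : ∀ r ∈ Icc R ρ, v r ≤ C * r ^ (2 - a) := by
    by_contra! hcon
    obtain ⟨r, hr, hlt⟩ := hcon
    have hclosed : IsClosed {x ∈ Icc R ρ | C * x ^ (2 - a) ≤ v x} :=
      isClosed_Icc.isClosed_le hcr hcont
    have hcomp : IsCompact {x ∈ Icc R ρ | C * x ^ (2 - a) ≤ v x} :=
      isCompact_Icc.of_isClosed_subset hclosed fun x hx => hx.1
    obtain ⟨s, ⟨hs, hsle⟩, hmin⟩ := hcomp.exists_isLeast ⟨r, hr, hlt.le⟩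
    have hRs : R < s := by
      refine lt_of_le_of_ne hs.1 ?_
      rintro rfl
      linarith
    have hsρ : s < ρ := by
      refine lt_of_le_of_ne hs.2 ?_
      rintro rfl
      have : 0 < s := by linarith
      have : 0 < C * s ^ (2 - a) := by positivity
      linarith
    have hbelow : ∀ x ∈ Ico R s, v x ≤ C * x ^ (2 - a) := by
      intro x hx
      by_contra! hx'
      exact absurd (hmin ⟨⟨hx.1, (hx.2.trans hsρ).le⟩, hx'.le⟩) (not_le.2 hx.2)
    have hsub : Ico R s ⊆ Icc R ρ := fun x hx => ⟨hx.1, (hx.2.trans hsρ).le⟩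
    have heq : v s = C * s ^ (2 - a) := by
      refine le_antisymm ?_ hsle
      refine ContinuousWithinAt.closure_le (s := Ico R s) ?_ ((hcont s hs).mono hsub)
        ((hcr s hs).mono hsub) hbelow
      rw [closure_Ico hRs.ne]
      exact ⟨hRs.le, le_rfl⟩
    refine (hv.mono hRs.le).false_of_eq hLam ha (hR.trans hRs.le) hp hpq hB hC hθ hθq hCB hpγ hS
      hSB ?_ hsρ (hcont.mono (Icc_subset_Icc_left hRs.le)) hvρ ?_ heq
    · refine le_trans ?_ hRS
      have : s ^ (-(2 * γ)) ≤ R ^ (-(2 * γ)) :=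
        rpow_le_rpow_of_nonpos hR0 hRs.le (by linarith)
      gcongr
    · exact hv.flux_le_of_le hLam hR (by linarith) hpq hC hγ hpγ hRB hflux ⟨hRs.le, hsρ⟩
        fun x hx => hbelow x ⟨hx.1.le, hx.2⟩
  refine ⟨key, fun r hr => ?_⟩
  exact hv.flux_le_of_le hLam hR (by linarith) hpq hC hγ hpγ hRB hflux hr
    fun x hx => key x ⟨hx.1.le, (hx.2.trans hr.2).le⟩

end IsConvexTail

namespace IsRadialProfile

variable {a lam Lam k p q ρ : ℝ} {v U : ℝ → ℝ}

lemma deriv_deriv_pos_iff (hlam : 0 < lam) (hLam : 0 < Lam) (hv : IsRadialProfile lam Lam k p ρ v)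
    {r : ℝ} (hr : r ∈ Ioo 0 ρ) : 0 < deriv (deriv v) r ↔ k * (deriv v r / r) + v r ^ p < 0 := by
  have h := hv.equation r hr
  constructor
  · intro h'
    rw [max_eq_left h'.le, min_eq_right h'.le] at h
    nlinarith
  · intro h'
    by_contra! hcon
    rw [max_eq_right hcon, min_eq_left hcon] at h
    nlinarith

lemma isConvexTail (hv : IsRadialProfile lam Lam (Lam * (a - 1)) p ρ v) {R : ℝ} (hR : 0 < R)
    (hconv : ∀ r ∈ Ico R ρ, 0 < deriv (deriv v) r) : IsConvexTail a Lam p R ρ v where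
  hasDerivAt r hr := hv.hasDerivAt r ⟨hR.trans_le hr.1, hr.2⟩
  hasDerivAt_deriv r hr := hv.hasDerivAt_deriv r ⟨hR.trans_le hr.1, hr.2⟩
  pos r hr := hv.pos r ⟨(hR.trans_le hr.1).le, hr.2⟩
  deriv_nonpos r hr := hv.deriv_nonpos r ⟨hR.trans_le hr.1, hr.2⟩
  deriv_deriv_pos := hconv
  equation r hr := by
    have h := hv.equation r ⟨hR.trans_le hr.1, hr.2⟩
    rw [max_eq_left (hconv r hr).le, min_eq_right (hconv r hr).le] at h
    linarith

/-- Profiles with exponents converging to `q` converge in `C¹` on compact sets to an entire profile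
with exponent `q`, and their radii of positivity tend to infinity. -/
lemma eventually_abs_sub_le (hlam : 0 < lam) (hlL : lam ≤ Lam) (hk : 0 ≤ k)
    {P σ : ℕ → ℝ} {w : ℕ → ℝ → ℝ} (hP1 : ∀ n, 1 ≤ P n) (hPq : ∀ n, P n ≤ q)
    (hP : Tendsto P atTop (nhds q)) (hw : ∀ n, IsRadialProfile lam Lam k (P n) (σ n) (w n))
    (hσ : ∀ n, 0 < σ n) (hcont : ∀ n, ContinuousOn (w n) (Icc 0 (σ n))) (hwσ : ∀ n, w n (σ n) = 0)
    (hU : ∀ ρ, IsRadialProfile lam Lam k q ρ U) {R δ : ℝ} (hR : 0 < R) (hδ : 0 < δ) :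
    ∀ᶠ n in atTop, R < σ n ∧
      ∀ r ∈ Icc 0 R, |w n r - U r| ≤ δ ∧ |deriv (w n) r - deriv U r| ≤ δ := by
  have hUR : 0 < U R := (hU (R + 1)).pos R ⟨hR.le, by linarith⟩
  set δ' := min δ (U R / 2) with hδ'
  have hδ'0 : 0 < δ' := lt_min hδ (by linarith)
  have hlim : Tendsto (fun n => (q - P n) ^ 2 * exp ((1 + (q + 1) / lam) * R)) atTop (nhds 0) := by
    have := ((tendsto_const_nhds (x := q)).sub hP).pow 2 |>.mul_const
      (exp ((1 + (q + 1) / lam) * R))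
    simpa using this
  filter_upwards [hlim.eventually (eventually_le_nhds (show 0 < δ' ^ 2 by positivity))] with n hn
  have hq : 0 ≤ q := by linarith [hP1 n, hPq n]
  have hle : ∀ r ∈ Icc 0 R, r < σ n → |w n r - U r| ≤ δ' ∧ |deriv (w n) r - deriv U r| ≤ δ' := by
    intro r hr hrσ
    have h1 := sq_add_sq_le hlam hlL hk (hP1 n) (hPq n) (hw n) (hU (σ n)) ⟨hr.1, hrσ⟩
    have h2 : (q - P n) ^ 2 * exp ((1 + (q + 1) / lam) * r) ≤ δ' ^ 2 := by
      refine le_trans ?_ hn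
      gcongr
      exact hr.2
    constructor <;> refine abs_le_of_sq_le_sq ?_ hδ'0.le
    · linarith [sq_nonneg (deriv (w n) r - deriv U r)]
    · linarith [sq_nonneg (w n r - U r)]
  have hRσ : R < σ n := by
    by_contra! hcon
    have hsub : Ico 0 (σ n) ⊆ Icc 0 (σ n) := Ico_subset_Icc_self
    have hc : ContinuousOn U (Icc 0 (σ n)) :=
      (hU (σ n + 1)).cont.mono fun x hx => ⟨hx.1, by linarith [hx.2]⟩
    have hmem : σ n ∈ Icc 0 (σ n) := ⟨(hσ n).le, le_rfl⟩
    have h1 : |w n (σ n) - U (σ n)| ≤ δ' := by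
      refine ContinuousWithinAt.closure_le (s := Ico 0 (σ n)) (f := fun r => |w n r - U r|)
        (g := fun _ => δ') ?_ ?_ continuousWithinAt_const ?_
      · rw [closure_Ico (hσ n).ne]
        exact hmem
      · exact (((hcont n).sub hc).abs (σ n) hmem).mono hsub
      · exact fun r hr => (hle r ⟨hr.1, hr.2.le.trans hcon⟩ hr.2).1
    have h2 : U R ≤ U (σ n) :=
      (hU (R + 1)).antitoneOn ⟨(hσ n).le, by linarith⟩ ⟨hR.le, by linarith⟩ hcon
    rw [hwσ, zero_sub, abs_neg, abs_of_pos (hUR.trans_le h2)] at h1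
    linarith [min_le_right δ (U R / 2)]
  refine ⟨hRσ, fun r hr => ?_⟩
  have := hle r hr (hr.2.trans_lt hRσ)
  exact ⟨this.1.trans (min_le_left _ _), this.2.trans (min_le_left _ _)⟩

end IsRadialProfile

/-- A convex tail with fast decay can exist only for exponents above the Serrin exponent
`a / (a - 2)`. -/
lemma lt_mul_of_tendsto_fast_decay {a Lam p R c L : ℝ} {U : ℝ → ℝ} (hLam : 0 < Lam) (hR : 0 < R)
    (hp : 0 ≤ p) (hc : 0 < c) (hU : ∀ ρ, IsConvexTail a Lam p R ρ U)
    (hlim : Tendsto (fun r => r ^ (a - 2) * U r) atTop (nhds c))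
    (hflux : Tendsto (radialFlux a U) atTop (nhds L)) : a < p * (a - 2) := by
  by_contra! hcon
  obtain ⟨R1, hR1⟩ := eventually_atTop.1 (hlim.eventually (eventually_ge_nhds (half_lt_self hc)))
  set T := max R1 (max R 1) with hT
  have hT1 : 1 ≤ T := (le_max_right _ _).trans (le_max_right _ _)
  have hTR : R ≤ T := (le_max_left _ _).trans (le_max_right _ _)
  set κ := (c / 2) ^ p / Lam with hκ
  have hκ0 : 0 < κ := by positivity
  have hd : ∀ x ∈ Ici T, HasDerivAt (fun r => radialFlux a U r - κ * log r)
      (x ^ (a - 1) * U x ^ p / Lam - κ * x⁻¹) x := by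
    intro x hx
    have hx : T ≤ x := hx
    exact ((hU (x + 1)).hasDerivAt_flux hLam hR ⟨hTR.trans hx, by linarith⟩).sub
      ((hasDerivAt_log (by linarith)).const_mul κ)
  have hmono : MonotoneOn (fun r => radialFlux a U r - κ * log r) (Ici T) := by
    refine monotoneOn_of_deriv_nonneg (convex_Ici _)
      (fun x hx => (hd x hx).continuousAt.continuousWithinAt)
      (fun x hx => (hd x (interior_subset hx)).differentiableAt.differentiableWithinAt) ?_
    intro x hx
    have hx := interior_subset hx
    rw [(hd x hx).deriv]
    have hx : T ≤ x := hx
    have hx1 : 1 ≤ x := hT1.trans hx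
    have hx0 : 0 < x := by linarith
    have h1 : c / 2 * x ^ (2 - a) ≤ U x := by
      have h2 := hR1 x ((le_max_left _ _).trans hx)
      calc c / 2 * x ^ (2 - a) ≤ x ^ (a - 2) * U x * x ^ (2 - a) := by gcongr
        _ = (x ^ (a - 2) * x ^ (2 - a)) * U x := by ring
        _ = U x := by rw [← rpow_add hx0]; simp
    have h3 : (c / 2) ^ p * x⁻¹ ≤ x ^ (a - 1) * U x ^ p := by
      calc (c / 2) ^ p * x⁻¹ = (c / 2) ^ p * x ^ (-1 : ℝ) := by rw [rpow_neg_one]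
        _ ≤ (c / 2) ^ p * x ^ (a - 1 + (2 - a) * p) := by (gcongr; linarith)
        _ = x ^ (a - 1) * (c / 2 * x ^ (2 - a)) ^ p := by
          rw [mul_rpow (by positivity) (by positivity), ← rpow_mul hx0.le, rpow_add hx0]
          ring
        _ ≤ x ^ (a - 1) * U x ^ p := by gcongr
    have h4 : κ * x⁻¹ = (c / 2) ^ p * x⁻¹ / Lam := by rw [hκ]; ring
    rw [h4, sub_nonneg]
    gcongr
  refine not_tendsto_nhds_of_tendsto_atTop ?_ L hflux
  have h1 : Tendsto (fun r => (radialFlux a U T - κ * log T) + κ * log r) atTop atTop :=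
    tendsto_atTop_add_const_left _ _ (tendsto_log_atTop.const_mul_atTop hκ0)
  refine tendsto_atTop_mono' _ ?_ h1
  filter_upwards [eventually_ge_atTop T] with r hr
  have := hmono (mem_Ici.2 le_rfl) (mem_Ici.2 hr) hr
  simp only at this
  linarith

/-- Uniform decay of profiles whose exponents increase to the exponent of a fast-decaying entire
profile. -/
theorem IsRadialProfile.exists_eventually_le {a lam Lam q c R₀ : ℝ} {U : ℝ → ℝ} {P σ : ℕ → ℝ}
    {w : ℕ → ℝ → ℝ} (hlam : 0 < lam) (hlL : lam ≤ Lam) (ha : 2 < a)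
    (hP1 : ∀ n, 1 ≤ P n) (hPq : ∀ n, P n ≤ q) (hP : Tendsto P atTop (nhds q))
    (hw : ∀ n, IsRadialProfile lam Lam (Lam * (a - 1)) (P n) (σ n) (w n))
    (hσ : ∀ n, 0 < σ n) (hcont : ∀ n, ContinuousOn (w n) (Icc 0 (σ n))) (hwσ : ∀ n, w n (σ n) = 0)
    (hconv : ∀ n, ∀ R ∈ Ioo 0 (σ n), 0 < deriv (deriv (w n)) R →
      ∀ r ∈ Ico R (σ n), 0 < deriv (deriv (w n)) r)
    (hU : ∀ ρ, IsRadialProfile lam Lam (Lam * (a - 1)) q ρ U)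
    (hUconv : ∀ r, R₀ < r → 0 < deriv (deriv U) r) (hc : 0 < c)
    (hlim : Tendsto (fun r => r ^ (a - 2) * U r) atTop (nhds c))
    (hflux : Tendsto (radialFlux a U) atTop (nhds ((a - 2) * c))) :
    ∃ C > 0, ∀ᶠ n in atTop, ∀ r ∈ Ioo 0 (σ n),
      w n r ≤ C * r ^ (2 - a) ∧ |deriv (w n) r| ≤ C * r ^ (1 - a) := by
  have hLam : 0 < Lam := hlam.trans_le hlL
  have hq : 1 ≤ q := (hP1 0).trans (hPq 0)
  have ha2 : 0 < a - 2 := by linarith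
  have hk : 0 ≤ Lam * (a - 1) := mul_nonneg hLam.le (by linarith)
  have hserrin : a < q * (a - 2) := by
    have hpos : 0 < max R₀ 0 + 1 := by positivity
    refine lt_mul_of_tendsto_fast_decay hLam hpos (by linarith) hc
      (fun ρ => (hU ρ).isConvexTail hpos fun r hr => hUconv r ?_) hlim hflux
    linarith [hr.1, le_max_left R₀ 0]
  set γ := (q * (a - 2) - a) / 4 with hγ
  have hγ0 : 0 < γ := by rw [hγ]; linarith
  set B := (a - 2) * c + 1 with hB
  have hB0 : 0 < B := by positivity
  set θ := 1 / (8 * q * a) with hθ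
  have hθ0 : 0 < θ := by positivity
  set C := 1 + c + 2 * B / ((a - 2) * θ) with hC
  have hC1 : 1 + c ≤ C := by
    have : 0 < 2 * B / ((a - 2) * θ) := by positivity
    linarith
  have hC0 : 0 < C := by linarith
  have hCB : 2 * B ≤ C * ((a - 2) * θ) := by
    rw [← div_le_iff₀ (by positivity)]
    linarith
  obtain ⟨S, hS1, hSB⟩ : ∃ S : ℝ, 1 ≤ S ∧
      8 * B * Lam * a ^ 2 ≤ 2 * Lam * a * θ * C * S ^ (a - 2) := by
    have h1 : Tendsto (fun S : ℝ => 2 * Lam * a * θ * C * S ^ (a - 2)) atTop atTop :=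
      (tendsto_rpow_atTop ha2).const_mul_atTop (by positivity)
    exact ((eventually_ge_atTop 1).and (h1.eventually_ge_atTop _)).exists
  have hdec : Tendsto (fun R : ℝ => C ^ q * R ^ (-(2 * γ))) atTop (nhds 0) := by
    simpa using (tendsto_rpow_neg_atTop (show 0 < 2 * γ by positivity)).const_mul (C ^ q)
  obtain ⟨R, hR1, hR0R, hRS, hRB, hRflux, hRU⟩ : ∃ R : ℝ, 1 ≤ R ∧ R₀ < R ∧
      C ^ q * R ^ (-(2 * γ)) ≤ 2 * Lam * a * θ / S ^ 2 ∧
      C ^ q * R ^ (-(2 * γ)) ≤ 2 * γ * Lam * B ∧ radialFlux a U R < B ∧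
      R ^ (a - 2) * U R < C :=
    ((eventually_ge_atTop 1).and <| (eventually_gt_atTop R₀).and <|
      (hdec.eventually (eventually_le_nhds (by positivity))).and <|
      (hdec.eventually (eventually_le_nhds (by positivity))).and <|
      (hflux.eventually (eventually_lt_nhds (by rw [hB]; linarith))).and
      (hlim.eventually (eventually_lt_nhds (by linarith)))).exists
  have hR0 : 0 < R := by linarith
  rw [le_div_iff₀ (by positivity)] at hRS
  have hclose := fun {δ : ℝ} (hδ : 0 < δ) => IsRadialProfile.eventually_abs_sub_le hlam hlL hk hP1
    hPq hP hw hσ hcont hwσ hU hR0 hδ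
  have hRmem : R ∈ Icc 0 R := ⟨hR0.le, le_rfl⟩
  have htend : Tendsto (fun n => w n R) atTop (nhds (U R)) := by
    refine Metric.tendsto_nhds.2 fun δ hδ => ?_
    filter_upwards [hclose (half_pos hδ)] with n hn
    rw [Real.dist_eq]
    linarith [(hn.2 R hRmem).1]
  have htend' : Tendsto (fun n => deriv (w n) R) atTop (nhds (deriv U R)) := by
    refine Metric.tendsto_nhds.2 fun δ hδ => ?_
    filter_upwards [hclose (half_pos hδ)] with n hn
    rw [Real.dist_eq]
    linarith [(hn.2 R hRmem).2]
  have hUR := hU (R + 1)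
  have hURpos : 0 < U R := hUR.pos R ⟨hR0.le, by linarith⟩
  have ev_conv : ∀ᶠ n in atTop, Lam * (a - 1) * (deriv (w n) R / R) + w n R ^ P n < 0 := by
    refine Tendsto.eventually_lt_const
      (v := Lam * (a - 1) * (deriv U R / R) + U R ^ q) ?_ ?_
    · exact (hUR.deriv_deriv_pos_iff hlam hLam ⟨hR0, by linarith⟩).1 (hUconv R hR0R)
    · exact ((htend'.div_const R).const_mul _).add (htend.rpow hP (Or.inl hURpos.ne'))
  have ev_flux : ∀ᶠ n in atTop, radialFlux a (w n) R < B :=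
    ((htend'.const_mul (R ^ (a - 1))).neg).eventually_lt_const hRflux
  have ev_lt : ∀ᶠ n in atTop, w n R < C * R ^ (2 - a) := by
    refine htend.eventually_lt_const ?_
    calc U R = R ^ (a - 2) * U R * R ^ (2 - a) := by
          rw [mul_right_comm, ← rpow_add hR0]; simp
      _ < C * R ^ (2 - a) := by gcongr
  have ev_P : ∀ᶠ n in atTop, 2 * γ ≤ P n * (a - 2) - a := by
    have : Tendsto (fun n => P n * (a - 2) - a) atTop (nhds (q * (a - 2) - a)) :=
      (hP.mul_const _).sub_const _
    exact this.eventually_const_le (by rw [hγ]; linarith)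
  obtain ⟨K, hK⟩ : ∃ K, ∀ r ∈ Icc 0 R, ‖deriv U r‖ ≤ K :=
    isCompact_Icc.exists_bound_of_continuousOn
      (hUR.cont_deriv.mono fun x hx => ⟨hx.1, by linarith [hx.2]⟩)
  have hK0 : 0 ≤ K := (norm_nonneg _).trans (hK 0 ⟨le_rfl, hR0.le⟩)
  set D := C + 2 * B + R ^ (a - 2) + (K + 1) * R ^ (a - 1) with hD
  have hR2 : 0 < R ^ (a - 2) := by positivity
  have hR3 : 0 < (K + 1) * R ^ (a - 1) := by positivity
  have hD0 : 0 < D := by positivity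
  refine ⟨D, hD0, ?_⟩
  filter_upwards [ev_conv, ev_flux, ev_lt, ev_P, hclose one_pos] with n h1 h2 h3 h4 h5
  obtain ⟨hRσ, h5⟩ := h5
  have hRmem' : R ∈ Ioo 0 (σ n) := ⟨hR0, hRσ⟩
  have htail := (hw n).isConvexTail hR0
    (hconv n R hRmem' (((hw n).deriv_deriv_pos_iff hlam hLam hRmem').2 h1))
  obtain ⟨hbd, hbd'⟩ := htail.le_and_flux_le (γ := γ) (θ := θ) (S := S) (q := q) hLam ha hR1 (hP1 n)
    (hPq n) hB0.le (by linarith) hθ0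
    (by rw [hθ]; field_simp; rfl) hCB hγ0 h4 hS1 hSB hRS hRB
    ((hcont n).mono (Icc_subset_Icc_left hR0.le)) (hwσ n) h2.le h3
  intro r hr
  have hr0 : 0 < r := hr.1
  rcases le_total R r with hRr | hrR
  · constructor
    · refine (hbd r ⟨hRr, hr.2.le⟩).trans ?_
      gcongr
      linarith
    · rw [abs_of_nonpos ((hw n).deriv_nonpos r hr), deriv_eq_neg_radialFlux_mul (a := a) _ hr0,
        neg_neg]
      gcongr
      linarith [hbd' r ⟨hRr, hr.2⟩]
  · constructor
    · have h6 : R ^ (2 - a) ≤ r ^ (2 - a) := rpow_le_rpow_of_nonpos hr0 hrR (by linarith)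
      calc w n r ≤ 1 := (hw n).le_one ⟨hr0.le, hr.2⟩
        _ = R ^ (a - 2) * R ^ (2 - a) := by rw [← rpow_add hR0]; simp
        _ ≤ R ^ (a - 2) * r ^ (2 - a) := by gcongr
        _ ≤ D * r ^ (2 - a) := by gcongr; linarith
    · have h6 : R ^ (1 - a) ≤ r ^ (1 - a) := rpow_le_rpow_of_nonpos hr0 hrR (by linarith)
      have h7 : |deriv (w n) r| ≤ K + 1 := by
        have h8 := hK r ⟨hr0.le, hrR⟩
        rw [Real.norm_eq_abs] at h8
        have h9 := (h5 r ⟨hr0.le, hrR⟩).2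
        have h10 := abs_add_le (deriv (w n) r - deriv U r) (deriv U r)
        rw [sub_add_cancel] at h10
        linarith
      calc |deriv (w n) r| ≤ K + 1 := h7
        _ = (K + 1) * (R ^ (a - 1) * R ^ (1 - a)) := by rw [← rpow_add hR0]; simp
        _ = (K + 1) * R ^ (a - 1) * R ^ (1 - a) := by ring
        _ ≤ (K + 1) * R ^ (a - 1) * r ^ (1 - a) := by gcongr
        _ ≤ D * r ^ (1 - a) := by gcongr; linarith

lemma ContDiffOn.hasDerivAt_deriv_and {f : ℝ → ℝ} {s : Set ℝ} (hf : ContDiffOn ℝ 2 f s) {x : ℝ}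
    (hx : x ∈ interior s) :
    HasDerivAt f (deriv f x) x ∧ HasDerivAt (deriv f) (deriv (deriv f) x) x := by
  have h1 : ContDiffOn ℝ 2 f (interior s) := hf.mono interior_subset
  have h2 : ContDiffOn ℝ 1 (deriv f) (interior s) :=
    h1.deriv_of_isOpen isOpen_interior (by norm_num)
  have hmem := isOpen_interior.mem_nhds hx
  exact ⟨((h1.contDiffAt hmem).differentiableAt (by norm_num)).hasDerivAt,
    ((h2.contDiffAt hmem).differentiableAt (by norm_num)).hasDerivAt⟩

lemma abs_deriv_le_of_forall_Ioo {f g : ℝ → ℝ} {b : ℝ} (hb : 0 < b)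
    (hf : ContDiffOn ℝ 2 f (Icc 0 b)) (hg : ContinuousAt g b) (hg0 : 0 ≤ g b)
    (h : ∀ x ∈ Ioo 0 b, |deriv f x| ≤ g x) : |deriv f b| ≤ g b := by
  by_cases hd : DifferentiableAt ℝ f b
  · have hmem : b ∈ Icc 0 b := ⟨hb.le, le_rfl⟩
    rw [← hd.derivWithin (uniqueDiffOn_Icc hb b hmem)]
    have hc := (hf.continuousOn_derivWithin (uniqueDiffOn_Icc hb) (by norm_num)).abs
    refine ContinuousWithinAt.closure_le (s := Ioo 0 b) (f := fun x => |derivWithin f (Icc 0 b) x|)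
      ?_ ((hc b hmem).mono Ioo_subset_Icc_self) hg.continuousWithinAt ?_
    · rw [closure_Ioo hb.ne]
      exact hmem
    · intro x hx
      have : derivWithin f (Icc 0 b) x = deriv f x :=
        derivWithin_of_mem_nhds (Icc_mem_nhds hx.1 hx.2)
      simpa only [this] using h x hx
  · rw [deriv_zero_of_not_differentiableAt hd]
    simpa using hg0

lemma continuousOn_deriv_of_contDiffOn {f : ℝ → ℝ} {b : ℝ} (hf : ContDiffOn ℝ 2 f (Icc 0 b))
    (h0 : deriv (deriv f) 0 ≠ 0) : ContinuousOn (deriv f) (Ico 0 b) := by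
  intro x hx
  rcases hx.1.eq_or_lt with rfl | h
  · exact (differentiableAt_of_deriv_ne_zero h0).continuousAt.continuousWithinAt
  · exact (hf.hasDerivAt_deriv_and (by rw [interior_Icc]; exact ⟨h, hx.2⟩)).2.continuousAt
      |>.continuousWithinAt

lemma radialPucci_of_deriv_nonpos {lam Lam : ℝ} {N : ℕ} {u : ℝ → ℝ} {r : ℝ} (hr : 0 < r)
    (h : deriv u r ≤ 0) : radialPucci lam Lam N u r =
      Lam * max (deriv (deriv u) r) 0 + lam * min (deriv (deriv u) r) 0 +
        lam * ((N : ℝ) - 1) * (deriv u r / r) := by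
  have h1 : deriv u r / r ≤ 0 := div_nonpos_of_nonpos_of_nonneg h hr.le
  rw [radialPucci, max_eq_right h1, min_eq_left h1]
  ring

lemma IsEntireSol.isRadialProfile {lam Lam Ntil p c1 R0 : ℝ} {N : ℕ} {U : ℝ → ℝ}
    (hU : IsEntireSol lam Lam N Ntil p c1 R0 U) (ρ : ℝ) :
    IsRadialProfile lam Lam (lam * ((N : ℝ) - 1)) p ρ U := by
  obtain ⟨hd, hpos, h0, h0', hneg, heq, hR0, hconc, -⟩ := hU
  have hint : ∀ r ∈ Ioo 0 ρ, r ∈ interior (Ici (0 : ℝ)) := fun r hr => by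
    rw [interior_Ici]; exact hr.1
  refine ⟨hd.continuousOn.mono Ico_subset_Ici_self,
    continuousOn_deriv_of_contDiffOn (hd.mono Icc_subset_Ici_self) (hconc 0 ⟨le_rfl, hR0⟩).ne,
    fun r hr => (hd.hasDerivAt_deriv_and (hint r hr)).1,
    fun r hr => (hd.hasDerivAt_deriv_and (hint r hr)).2, h0, h0', fun r hr => hpos r hr.1,
    fun r hr => (hneg r hr.1).le, fun r hr => ?_⟩
  rw [← radialPucci_of_deriv_nonpos hr.1 (hneg r hr.1).le, ← heq r hr.1, neg_neg]

lemma deriv_const_mul_comp_div (f : ℝ → ℝ) (c ρ : ℝ) :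
    deriv (fun r => c * f (r / ρ)) = fun r => c * ρ⁻¹ * deriv f (r / ρ) := by
  funext r
  rw [deriv_const_mul_field]
  have h := deriv_comp_mul_left ρ⁻¹ f r
  simp only [smul_eq_mul, inv_mul_eq_div] at h
  rw [h]
  ring

lemma IsDirichletSol.isRadialProfile_rescale {lam Lam p ρ : ℝ} {N : ℕ} {u : ℝ → ℝ}
    (hu : IsDirichletSol lam Lam N p u) (h0 : deriv (deriv u) 0 ≠ 0)
    (hρ : ρ = u 0 ^ ((p - 1) / 2)) :
    IsRadialProfile lam Lam (lam * ((N : ℝ) - 1)) p ρ (fun r => (u 0)⁻¹ * u (r / ρ)) := by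
  obtain ⟨hd, hpos, -, h0', hneg, heq⟩ := hu
  have hM : 0 < u 0 := hpos 0 ⟨le_rfl, one_pos⟩
  have hρ0 : 0 < ρ := by rw [hρ]; positivity
  set M := u 0
  have hρ2 : ρ ^ 2 * M = M ^ p := by
    rw [hρ, ← rpow_natCast, ← rpow_mul hM.le]
    nth_rewrite 2 [← rpow_one M]
    rw [← rpow_add hM]
    congr 1
    push_cast
    ring
  have hIco : ∀ r ∈ Ico 0 ρ, r / ρ ∈ Ico (0 : ℝ) 1 := fun r hr =>
    ⟨div_nonneg hr.1 hρ0.le, (div_lt_one hρ0).2 hr.2⟩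
  have hIoo : ∀ r ∈ Ioo 0 ρ, r / ρ ∈ Ioo (0 : ℝ) 1 := fun r hr =>
    ⟨div_pos hr.1 hρ0, (div_lt_one hρ0).2 hr.2⟩
  have hcomp : ∀ {f : ℝ → ℝ} (c : ℝ), ContinuousOn f (Ico 0 1) →
      ContinuousOn (fun r => c * f (r / ρ)) (Ico 0 ρ) := fun c hf =>
    continuousOn_const.mul (hf.comp (by fun_prop) hIco)
  have hderiv : ∀ {f : ℝ → ℝ} (c r : ℝ), HasDerivAt f (deriv f (r / ρ)) (r / ρ) →
      HasDerivAt (fun r => c * f (r / ρ)) (c * ρ⁻¹ * deriv f (r / ρ)) r := by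
    intro f c r hf
    have h := (hf.comp r ((hasDerivAt_id r).div_const ρ)).const_mul c
    refine h.congr_deriv ?_
    ring
  have h1 := deriv_const_mul_comp_div u M⁻¹ ρ
  have h2 := deriv_const_mul_comp_div (deriv u) (M⁻¹ * ρ⁻¹) ρ
  have hint : ∀ r ∈ Ioo 0 ρ, r / ρ ∈ interior (Icc (0 : ℝ) 1) := fun r hr => by
    rw [interior_Icc]; exact hIoo r hr
  refine ⟨hcomp _ (hd.continuousOn.mono Ico_subset_Icc_self), ?_, ?_, ?_, ?_, ?_, ?_, ?_, ?_⟩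
  · rw [h1]
    exact hcomp _ (continuousOn_deriv_of_contDiffOn hd h0)
  · intro r hr
    rw [h1]
    exact hderiv _ _ (hd.hasDerivAt_deriv_and (hint r hr)).1
  · intro r hr
    rw [h1, h2]
    exact hderiv _ _ (hd.hasDerivAt_deriv_and (hint r hr)).2
  · simp [M, hM.ne']
  · rw [h1]
    simp [h0']
  · intro r hr
    exact mul_pos (inv_pos.2 hM) (hpos _ (hIco r hr))
  · intro r hr
    rw [h1]
    exact mul_nonpos_of_nonneg_of_nonpos (by positivity)
      (hneg _ ⟨(hIoo r hr).1.le, (hIoo r hr).2.le⟩)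
  · intro r hr
    have hx := hIoo r hr
    have hr0 : 0 < r := hr.1
    have h3 := heq _ hx
    rw [radialPucci_of_deriv_nonpos hx.1 (hneg _ ⟨hx.1.le, hx.2.le⟩)] at h3
    have hc : 0 ≤ M⁻¹ * ρ⁻¹ * ρ⁻¹ := by positivity
    have hu0 : 0 ≤ u (r / ρ) := (hpos _ ⟨hx.1.le, hx.2⟩).le
    have hmax : ∀ x : ℝ, max (M⁻¹ * ρ⁻¹ * ρ⁻¹ * x) 0 = M⁻¹ * ρ⁻¹ * ρ⁻¹ * max x 0 := fun x => by
      rw [mul_max_of_nonneg _ _ hc, mul_zero]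
    have hmin : ∀ x : ℝ, min (M⁻¹ * ρ⁻¹ * ρ⁻¹ * x) 0 = M⁻¹ * ρ⁻¹ * ρ⁻¹ * min x 0 := fun x => by
      rw [mul_min_of_nonneg _ _ hc, mul_zero]
    rw [h1, h2]
    simp only [hmax, hmin]
    rw [mul_rpow (by positivity) hu0, inv_rpow hM.le, ← hρ2, ← h3]
    field_simp

/-- Universal bounds for the rescaled solutions: `ũₙ(r) ≤ C·r^{2−Ñ}` and
`|ũₙ'(r)| ≤ C·r^{1−Ñ}` on `(0, ρₙ]`, with `C` independent of `n` large. -/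
theorem stmt_9 (lam Lam : ℝ) (N : ℕ) (Ntil pstar c1 R0 : ℝ)
    (hlam : 0 < lam) (hlL : lam ≤ Lam) (hN : 2 ≤ N)
    (hNtil : Ntil = lam / Lam * ((N : ℝ) - 1) + 1) (hNtil2 : 2 < Ntil)
    (hpstar : 1 < pstar)
    (U : ℝ → ℝ) (hU : IsEntireSol lam Lam N Ntil pstar c1 R0 U)
    (hnonex : ¬ ∃ w : ℝ → ℝ, IsDirichletSol lam Lam N pstar w)
    (ε : ℕ → ℝ) (hε : ∀ n, 0 < ε n) (hε0 : Tendsto ε atTop (nhds 0))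
    (hpn : ∀ n, 1 < pstar - ε n)
    (u : ℕ → ℝ → ℝ) (hu : ∀ n, IsDirichletSol lam Lam N (pstar - ε n) (u n))
    (r0 : ℕ → ℝ) (hr0 : ∀ n, InflectionAt (u n) (r0 n))
    (tilde : ℕ → ℝ → ℝ)
    (htilde : ∀ n, tilde n =
      fun r => (u n 0)⁻¹ * u n (r / (u n 0) ^ ((pstar - ε n - 1) / 2))) :
    ∃ C > 0, ∃ n0 : ℕ, ∀ n ≥ n0,
      ∀ r ∈ Set.Ioc (0 : ℝ) ((u n 0) ^ ((pstar - ε n - 1) / 2)),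
        tilde n r ≤ C * r ^ (2 - Ntil) ∧ |deriv (tilde n) r| ≤ C * r ^ (1 - Ntil) := by
  have hLam : 0 < Lam := hlam.trans_le hlL
  have hk : Lam * (Ntil - 1) = lam * ((N : ℝ) - 1) := by
    rw [hNtil]; field_simp; ring
  set σ : ℕ → ℝ := fun n => (u n 0) ^ ((pstar - ε n - 1) / 2) with hσdef
  have hM : ∀ n, 0 < u n 0 := fun n => (hu n).2.1 0 ⟨le_rfl, one_pos⟩
  have hσ : ∀ n, 0 < σ n := fun n => rpow_pos_of_pos (hM n) _
  have htilde' : ∀ n, tilde n = fun r => (u n 0)⁻¹ * u n (r / σ n) := htilde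
  have hcd : ∀ n, ContDiffOn ℝ 2 (tilde n) (Icc 0 (σ n)) := by
    intro n
    rw [htilde' n]
    refine contDiffOn_const.mul ((hu n).1.comp (by fun_prop) fun r hr => ?_)
    exact ⟨div_nonneg hr.1 (hσ n).le, (div_le_one (hσ n)).2 hr.2⟩
  have hzero : ∀ n, tilde n (σ n) = 0 := by
    intro n
    simp [htilde' n, (hσ n).ne', (hu n).2.2.1]
  have hprof : ∀ n, IsRadialProfile lam Lam (Lam * (Ntil - 1)) (pstar - ε n) (σ n) (tilde n) := by
    intro n
    rw [hk, htilde' n]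
    exact (hu n).isRadialProfile_rescale ((hr0 n).2.1 0 ⟨le_rfl, (hr0 n).1.1⟩).ne rfl
  have hconv : ∀ n, ∀ R ∈ Ioo 0 (σ n), 0 < deriv (deriv (tilde n)) R →
      ∀ r ∈ Ico R (σ n), 0 < deriv (deriv (tilde n)) r := by
    intro n R hR hpos r hr
    obtain ⟨-, hlt, heq, hgt⟩ := hr0 n
    have hMn := hM n
    have hσn := hσ n
    have hdd : ∀ x, deriv (deriv (tilde n)) x =
        (u n 0)⁻¹ * (σ n)⁻¹ * (σ n)⁻¹ * deriv (deriv (u n)) (x / σ n) := by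
      intro x
      rw [htilde' n, deriv_const_mul_comp_div, deriv_const_mul_comp_div]
    have hc : 0 < (u n 0)⁻¹ * (σ n)⁻¹ * (σ n)⁻¹ := by positivity
    rw [hdd] at hpos ⊢
    have hpos' := pos_of_mul_pos_right hpos hc.le
    refine mul_pos hc (hgt _ ⟨?_, (div_lt_one hσn).2 hr.2⟩)
    have hRr : R / σ n ≤ r / σ n := by gcongr; exact hr.1
    refine lt_of_lt_of_le ?_ hRr
    by_contra! hcon
    rcases hcon.eq_or_lt with h | h
    · rw [h, heq] at hpos'
      exact lt_irrefl _ hpos'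
    · exact absurd (hlt _ ⟨div_nonneg hR.1.le hσn.le, h⟩) (not_lt.2 hpos'.le)
  have hflux : Tendsto (radialFlux Ntil U) atTop (nhds ((Ntil - 2) * c1)) := by
    have h := hU.2.2.2.2.2.2.2.2.2.2.2.2.neg
    rwa [neg_mul, neg_neg] at h
  have hlim := hU.2.2.2.2.2.2.2.2.2.2.2.1
  obtain ⟨C, hC, hev⟩ := IsRadialProfile.exists_eventually_le hlam hlL hNtil2
    (fun n => (hpn n).le) (fun n => by linarith [hε n])
    (by simpa using (tendsto_const_nhds (x := pstar)).sub hε0) hprof hσ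
    (fun n => (hcd n).continuousOn) hzero hconv
    (fun ρ => hk ▸ hU.isRadialProfile ρ) hU.2.2.2.2.2.2.2.2.2.1 hU.2.2.2.2.2.2.2.2.2.2.1 hlim hflux
  obtain ⟨n0, hn0⟩ := eventually_atTop.1 hev
  refine ⟨C, hC, n0, fun n hn r hr => ?_⟩
  rcases hr.2.eq_or_lt with h | h
  · have hr' : 0 < r := hr.1
    have h' : r = σ n := h
    refine ⟨?_, ?_⟩
    · rw [h', hzero]
      rw [h'] at hr'
      positivity
    · rw [h'] at hr' ⊢
      refine abs_deriv_le_of_forall_Ioo (g := fun r => C * r ^ (1 - Ntil)) hr' (hcd n) ?_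
        (by positivity) fun x hx => (hn0 n hn x hx).2
      exact continuousAt_const.mul (continuousAt_rpow_const _ _ (Or.inl hr'.ne'))
  · exact hn0 n hn r ⟨hr.1, h⟩
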